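/- Let k be a field, R = k[x_0,…,x_N] with maximal homogeneous ideal 𝔪 = (x_0,…,x_N), and let 1 ≤ h ≤ N and n ≥ h be integers. Let F_1,…,F_n ∈ R be homogeneous polynomials such that any subset of at most h+1 of them forms a complete intersection (i.e., a regular sequence on R), and let I = ⋂_{1 ≤ i_1 < … < i_h ≤ n} (F_{i_1},…,F_{i_h}) be the defining ideal of the corresponding codimension-h star configuration. Then for all integers m, r ≥ 1 one has the containment I^{(r(m+h−1))} ⊆ 𝔪^{r(h−1)} · (I^{(m)})^r. -/

import Mathlib

/-- The `n`-th symbolic power of an ideal `I`: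
`f ∈ I^{(n)}` iff for every associated prime `P` of `R/I` there is `s ∉ P` with `s*f ∈ I^n`.
(For a prime ideal `I` this is exactly `{f | ∃ s ∉ I, s*f ∈ I^n} = Iⁿ R_I ∩ R`.) -/
def symbolicPower {R : Type*} [CommRing R] (I : Ideal R) (n : ℕ) : Ideal R where
  carrier := {f | ∀ P ∈ associatedPrimes R (R ⧸ I), ∃ s, s ∉ P ∧ s * f ∈ I ^ n}
  zero_mem' := by
    intro P hP
    exact ⟨1, fun h => hP.1.ne_top ((Ideal.eq_top_iff_one P).mpr h), by simp⟩
  add_mem' := by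
    intro a b ha hb P hP
    obtain ⟨s, hs, hsa⟩ := ha P hP
    obtain ⟨t, ht, htb⟩ := hb P hP
    refine ⟨s * t, fun h => ((hP.1.mem_or_mem h).elim hs ht), ?_⟩
    have heq : s * t * (a + b) = t * (s * a) + s * (t * b) := by ring
    rw [heq]
    exact Ideal.add_mem _ (Ideal.mul_mem_left _ _ hsa) (Ideal.mul_mem_left _ _ htb)
  smul_mem' := by
    intro r a ha P hP
    obtain ⟨s, hs, hsa⟩ := ha P hP
    refine ⟨s, hs, ?_⟩
    have heq : s * (r • a) = r * (s * a) := by rw [smul_eq_mul]; ring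
    rw [heq]
    exact Ideal.mul_mem_left _ _ hsa

/-- `F` is generically regular modulo `J` up to length `d` on `V`: each `F i` with `i ∈ V` is a
nonzerodivisor modulo `J` and any fewer than `d` other members of the family indexed by `V`. -/
def IsGenericallyRegular {R ι : Type*} [CommRing R] (J : Ideal R) (F : ι → R) (V : Finset ι)
    (d : ℕ) : Prop :=
  ∀ T ⊆ V, T.card < d → ∀ i ∈ V, i ∉ T → ∀ u, F i * u ∈ J ⊔ Ideal.span (F '' ↑T) →
    u ∈ J ⊔ Ideal.span (F '' ↑T)

section GenericallyRegular

variable {R ι : Type*} [CommRing R]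

theorem Ideal.sup_pow_succ_le_mul_sup (P Q : Ideal R) (k : ℕ) :
    (P ⊔ Q) ^ (k + 1) ≤ P * (P ⊔ Q) ^ k ⊔ Q ^ (k + 1) := by
  induction k with
  | zero => simp
  | succ k ih =>
    calc (P ⊔ Q) ^ (k + 1 + 1) = P * (P ⊔ Q) ^ (k + 1) ⊔ Q * (P ⊔ Q) ^ (k + 1) := by
          rw [pow_succ' (P ⊔ Q) (k + 1), Ideal.sup_mul]
      _ ≤ P * (P ⊔ Q) ^ (k + 1) ⊔ Q * (P * (P ⊔ Q) ^ k ⊔ Q ^ (k + 1)) :=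
          sup_le_sup_left (Ideal.mul_mono_right ih) _
      _ ≤ _ := by
          rw [Ideal.mul_sup, ← pow_succ' Q]
          refine sup_le le_sup_left (sup_le (le_sup_of_le_left ?_) le_sup_right)
          rw [mul_left_comm, pow_succ' (P ⊔ Q)]
          exact Ideal.mul_mono_right (Ideal.mul_mono_left le_sup_right)

theorem Ideal.sup_pow_le_sup_pow_right (P Q : Ideal R) (k : ℕ) :
    (P ⊔ Q) ^ k ≤ P ⊔ Q ^ k := by
  cases k with
  | zero => simp
  | succ k =>
    exact (Ideal.sup_pow_succ_le_mul_sup P Q k).trans (sup_le_sup_right Ideal.mul_le_left _)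

theorem mem_sup_pow_of_mul_mem {J Q : Ideal R} {x : R}
    (hreg : ∀ k u, x * u ∈ J ⊔ Q ^ k → u ∈ J ⊔ Q ^ k) {k : ℕ} {v : R}
    (hv : x * v ∈ J ⊔ (Ideal.span {x} ⊔ Q) ^ (k + 1)) :
    v ∈ J ⊔ (Ideal.span {x} ⊔ Q) ^ k := by
  have h1 := sup_le_sup_left (Ideal.sup_pow_succ_le_mul_sup (Ideal.span {x}) Q k) J hv
  obtain ⟨j, hj, y, hy, hjy⟩ := Submodule.mem_sup.1 h1
  obtain ⟨z, hz, q, hq, rfl⟩ := Submodule.mem_sup.1 hy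
  obtain ⟨w, hw, rfl⟩ := Ideal.mem_span_singleton_mul.1 hz
  have h2 : v - w ∈ J ⊔ Q ^ (k + 1) := by
    refine hreg _ _ ?_
    have : x * (v - w) = j + q := by linear_combination -hjy
    rw [this]
    exact Submodule.add_mem_sup hj hq
  have h3 : J ⊔ Q ^ (k + 1) ≤ J ⊔ (Ideal.span {x} ⊔ Q) ^ k :=
    sup_le_sup_left ((Ideal.pow_le_pow_right k.le_succ).trans
      (Ideal.pow_right_mono le_sup_right k)) J
  have := add_mem (h3 h2) (Ideal.mem_sup_right hw : w ∈ J ⊔ _)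
  simpa using this

variable [DecidableEq ι]

theorem span_image_coe_insert (F : ι → R) (x : ι) (S : Finset ι) :
    Ideal.span (F '' ↑(insert x S)) = Ideal.span {F x} ⊔ Ideal.span (F '' ↑S) := by
  rw [Finset.coe_insert, Set.image_insert_eq, Ideal.span_insert]

namespace IsGenericallyRegular

variable {J : Ideal R} {F : ι → R} {V W : Finset ι} {d e : ℕ}

omit [DecidableEq ι] in
theorem mono (hF : IsGenericallyRegular J F V d) (hW : W ⊆ V) (he : e ≤ d) :
    IsGenericallyRegular J F W e :=
  fun T hT hd i hi => hF T (hT.trans hW) (hd.trans_le he) i (hW hi)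

theorem sup_span_singleton (hF : IsGenericallyRegular J F V (d + 1)) {x : ι} (hx : x ∈ V)
    (hxW : x ∉ W) (hW : W ⊆ V) :
    IsGenericallyRegular (J ⊔ Ideal.span {F x}) F W d := by
  intro T hT hd i hi hiT u hu
  rw [sup_assoc, ← span_image_coe_insert] at hu ⊢
  refine hF (insert x T) (Finset.insert_subset hx (hT.trans hW))
    ((Finset.card_insert_le _ _).trans_lt (by omega)) i (hW hi) ?_ u hu
  rw [Finset.mem_insert, not_or]
  exact ⟨fun h => hxW (h ▸ hi), hiT⟩

/-- If multiplication by the set `A` is jointly injective modulo `J + (F_S)`, then it is jointly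
injective modulo `J + (F_S)^k`. -/
theorem mem_sup_pow_of_forall_mul_mem {S : Finset ι} (hF : IsGenericallyRegular J F S S.card)
    {A : Set R} (hA : ∀ f, (∀ a ∈ A, a * f ∈ J ⊔ Ideal.span (F '' ↑S)) →
      f ∈ J ⊔ Ideal.span (F '' ↑S)) (k : ℕ) {f : R}
    (hf : ∀ a ∈ A, a * f ∈ J ⊔ Ideal.span (F '' ↑S) ^ k) :
    f ∈ J ⊔ Ideal.span (F '' ↑S) ^ k := by
  induction S using Finset.induction_on generalizing J A k f with
  | empty =>
    rcases k with _ | k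
    · simp
    · simp only [Finset.coe_empty, Set.image_empty, Ideal.span_empty, ne_eq,
        Nat.add_eq_zero_iff, one_ne_zero, and_false, not_false_eq_true, Ideal.bot_pow] at hA hf ⊢
      exact hA f hf
  | insert x S hx ih =>
    rw [Finset.card_insert_of_notMem hx] at hF
    have hxS : x ∈ insert x S := Finset.mem_insert_self x S
    have hSS : S ⊆ insert x S := Finset.subset_insert x S
    have hreg : ∀ k u, F x * u ∈ J ⊔ Ideal.span (F '' ↑S) ^ k →
        u ∈ J ⊔ Ideal.span (F '' ↑S) ^ k := fun k u hu =>
      ih (A := {F x}) (hF.mono hSS (Nat.le_succ _))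
        (fun f hf => hF S hSS (Nat.lt_succ_self _) x hxS hx f (hf _ rfl)) k (by simpa using hu)
    rw [span_image_coe_insert] at hA hf ⊢
    induction k generalizing f with
    | zero => simp
    | succ k ihk =>
      have h1 : f ∈ (J ⊔ Ideal.span {F x}) ⊔ Ideal.span (F '' ↑S) ^ (k + 1) := by
        refine ih (A := A) (hF.sup_span_singleton hxS hx hSS) ?_ (k + 1) fun a ha => ?_
        · simpa only [sup_assoc] using hA
        · rw [sup_assoc]
          exact sup_le_sup_left (Ideal.sup_pow_le_sup_pow_right _ _ _) J (hf a ha)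
      obtain ⟨y, hy, g, hg, rfl⟩ := Submodule.mem_sup.1 h1
      obtain ⟨j, hj, z, hz, rfl⟩ := Submodule.mem_sup.1 hy
      obtain ⟨u, rfl⟩ := Ideal.mem_span_singleton'.1 hz
      have hg' : g ∈ J ⊔ (Ideal.span {F x} ⊔ Ideal.span (F '' ↑S)) ^ (k + 1) :=
        Ideal.mem_sup_right (Ideal.pow_right_mono le_sup_right _ hg)
      have hu : u ∈ J ⊔ (Ideal.span {F x} ⊔ Ideal.span (F '' ↑S)) ^ k := by
        refine ihk fun a ha => mem_sup_pow_of_mul_mem hreg ?_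
        have h2 := sub_mem (sub_mem (hf a ha) (Ideal.mul_mem_left _ a hg'))
          (Ideal.mul_mem_left _ a (Ideal.mem_sup_left hj))
        convert h2 using 1
        ring
      refine add_mem (add_mem (Ideal.mem_sup_left hj) ?_) hg'
      obtain ⟨j', hj', w, hw, rfl⟩ := Submodule.mem_sup.1 hu
      rw [add_mul, mul_comm w, pow_succ']
      exact add_mem (Ideal.mem_sup_left (Ideal.mul_mem_right _ _ hj')) (Ideal.mem_sup_right
        (Ideal.mul_mem_mul (Ideal.mem_sup_left (Ideal.mem_span_singleton_self _)) hw))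

theorem mem_sup_pow_of_notMem (hF : IsGenericallyRegular J F V d) {S : Finset ι} (hS : S ⊆ V)
    (hd : S.card < d) {x : ι} (hx : x ∈ V) (hxS : x ∉ S) {k : ℕ} {u : R}
    (hu : F x * u ∈ J ⊔ Ideal.span (F '' ↑S) ^ k) : u ∈ J ⊔ Ideal.span (F '' ↑S) ^ k :=
  mem_sup_pow_of_forall_mul_mem (A := {F x}) (hF.mono hS hd.le)
    (fun f hf => hF S hS hd x hx hxS f (hf _ rfl)) k (by simpa using hu)

theorem mem_sup_pow_pred_of_mem (hF : IsGenericallyRegular J F V d) {S : Finset ι} (hS : S ⊆ V)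
    (hd : S.card ≤ d) {x : ι} (hxS : x ∈ S) {k : ℕ} {u : R}
    (hu : F x * u ∈ J ⊔ Ideal.span (F '' ↑S) ^ k) :
    u ∈ J ⊔ Ideal.span (F '' ↑S) ^ (k - 1) := by
  rcases k with _ | k
  · simp
  rw [← Finset.insert_erase hxS, span_image_coe_insert] at hu ⊢
  exact mem_sup_pow_of_mul_mem (fun k u hu => hF.mem_sup_pow_of_notMem
    ((Finset.erase_subset _ _).trans hS) ((Finset.card_erase_lt_of_mem hxS).trans_le hd) (hS hxS)
    (Finset.notMem_erase x S) hu) hu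

end IsGenericallyRegular

/-- The ideal generated by the monomials `∏ F i ^ a i` such that `a + c` has weight at least `m`
on every `h`-element subset of `V`. -/
def starMonomialIdeal (F : ι → R) (V : Finset ι) (h m : ℕ) (c : ι → ℕ) : Ideal R :=
  Ideal.span {f | ∃ a : ι → ℕ, (∀ S ⊆ V, S.card = h → m ≤ ∑ i ∈ S, (a i + c i)) ∧
    f = ∏ i ∈ V, F i ^ a i}

omit [DecidableEq ι] in
theorem prod_pow_mem_span_pow (F : ι → R) (a : ι → ℕ) (S : Finset ι) :
    ∏ i ∈ S, F i ^ a i ∈ Ideal.span (F '' ↑S) ^ ∑ i ∈ S, a i := by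
  rw [← Finset.prod_pow_eq_pow_sum]
  exact Ideal.prod_mem_prod fun i hi => Ideal.pow_mem_pow (Ideal.subset_span (Set.mem_image_of_mem F hi)) _

theorem starMonomialIdeal_le (F : ι → R) {V S : Finset ι} {h : ℕ} (m : ℕ) (c : ι → ℕ)
    (hS : S ⊆ V) (hSh : S.card = h) :
    starMonomialIdeal F V h m c ≤ Ideal.span (F '' ↑S) ^ (m - ∑ i ∈ S, c i) := by
  rw [starMonomialIdeal, Ideal.span_le]
  rintro _ ⟨a, ha, rfl⟩
  have h1 := ha S hS hSh
  rw [Finset.sum_add_distrib] at h1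
  rw [← Finset.prod_sdiff hS]
  exact Ideal.mul_mem_left _ _ (Ideal.pow_le_pow_right (by omega) (prod_pow_mem_span_pow F a S))

theorem starMonomialIdeal_erase_le (F : ι → R) {V : Finset ι} (h m : ℕ) {c : ι → ℕ} {x : ι}
    (hx : x ∈ V) (hmin : ∀ i ∈ V, c x ≤ c i) :
    starMonomialIdeal F (V.erase x) h (m - c x) c ≤ starMonomialIdeal F V (h + 1) m c := by
  refine Ideal.span_le.2 ?_
  rintro _ ⟨a, ha, rfl⟩
  refine Ideal.subset_span ⟨Function.update a x 0, fun S hS hSh => ?_, ?_⟩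
  · obtain ⟨y, hyS, hy⟩ : ∃ y ∈ S, x ∉ S.erase y := by
      by_cases hxS : x ∈ S
      · exact ⟨x, hxS, Finset.notMem_erase _ _⟩
      · obtain ⟨y, hy⟩ := Finset.card_pos.1 (by omega : 0 < S.card)
        exact ⟨y, hy, fun h => hxS (Finset.mem_of_mem_erase h)⟩
    have h1 := ha (S.erase y) (fun i hi => Finset.mem_erase.2
      ⟨fun h => hy (h ▸ hi), hS (Finset.mem_of_mem_erase hi)⟩)
      (by rw [Finset.card_erase_of_mem hyS]; omega)
    have h2 : ∑ i ∈ S.erase y, (Function.update a x 0 i + c i) = ∑ i ∈ S.erase y, (a i + c i) :=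
      Finset.sum_congr rfl fun i hi => by
        rw [Function.update_of_ne (ne_of_mem_of_not_mem hi hy)]
    rw [← Finset.add_sum_erase _ _ hyS, h2]
    have := hmin y (hS hyS)
    omega
  · rw [← Finset.mul_prod_erase _ _ hx, Function.update_self, pow_zero, one_mul]
    exact Finset.prod_congr rfl fun i hi => by
      rw [Function.update_of_ne (Finset.ne_of_mem_erase hi)]

theorem mul_mem_starMonomialIdeal (F : ι → R) {V : Finset ι} {h m : ℕ} {c : ι → ℕ} {x : ι}
    (hx : x ∈ V) {f : R} (hf : f ∈ starMonomialIdeal F V h m (c + Pi.single x 1)) :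
    F x * f ∈ starMonomialIdeal F V h m c := by
  induction hf using Submodule.span_induction with
  | zero => simp
  | add f g _ _ hf hg => rw [mul_add]; exact add_mem hf hg
  | smul r f _ hf => rw [smul_eq_mul, mul_left_comm]; exact Ideal.mul_mem_left _ _ hf
  | mem f hf =>
    obtain ⟨a, ha, rfl⟩ := hf
    refine Ideal.subset_span ⟨a + Pi.single x 1, fun S hS hSh => (ha S hS hSh).trans_eq
      (Finset.sum_congr rfl fun i _ => by simp only [Pi.add_apply]; ring), ?_⟩
    rw [← Finset.mul_prod_erase _ _ hx, ← Finset.mul_prod_erase V _ hx, Pi.add_apply,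
      Pi.single_eq_same, pow_succ', mul_assoc]
    refine congrArg _ (congrArg _ (Finset.prod_congr rfl fun i hi => ?_))
    simp [Finset.ne_of_mem_erase hi]

omit [DecidableEq ι] in
theorem starMonomialIdeal_eq_top (F : ι → R) {V : Finset ι} {h m : ℕ} {c : ι → ℕ}
    (hc : ∀ S ⊆ V, S.card = h → m ≤ ∑ i ∈ S, c i) : starMonomialIdeal F V h m c = ⊤ :=
  (Ideal.eq_top_iff_one _).2 (Ideal.subset_span ⟨0, by simpa using hc, by simp⟩)

/-- For a generically regular family, intersections of powers of the ideals `(F_S)`, with weights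
shifted by `c`, are generated by monomials in the family. -/
theorem IsGenericallyRegular.mem_sup_starMonomialIdeal {J : Ideal R} {F : ι → R} {V : Finset ι}
    {h : ℕ} (hF : IsGenericallyRegular J F V (h + 1)) (m : ℕ) (c : ι → ℕ) {f : R}
    (hf : ∀ S ⊆ V, S.card = h → f ∈ J ⊔ Ideal.span (F '' ↑S) ^ (m - ∑ i ∈ S, c i)) :
    f ∈ J ⊔ starMonomialIdeal F V h m c := by
  induction h generalizing J V m c f with
  | zero =>
    rcases Nat.eq_zero_or_pos m with rfl | hm
    · rw [starMonomialIdeal_eq_top F (by simp)]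
      simp
    · have := hf ∅ (Finset.empty_subset V) rfl
      refine Ideal.mem_sup_left ?_
      simpa [Ideal.bot_pow hm.ne'] using this
  | succ h ih =>
    induction hN : ∑ i ∈ V, (m - c i) using Nat.strong_induction_on generalizing c f with
    | _ N ihN =>
    by_cases hc : ∀ S ⊆ V, S.card = h + 1 → m ≤ ∑ i ∈ S, c i
    · rw [starMonomialIdeal_eq_top F hc]
      simp
    push Not at hc
    obtain ⟨S₀, hS₀V, hS₀, hS₀m⟩ := hc
    obtain ⟨y, hy⟩ := Finset.card_pos.1 (by omega : 0 < S₀.card)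
    obtain ⟨x, hx, hmin⟩ := Finset.exists_min_image V c ⟨y, hS₀V hy⟩
    have hxm : c x < m :=
      ((hmin y (hS₀V hy)).trans (Finset.single_le_sum (fun _ _ => Nat.zero_le _) hy)).trans_lt hS₀m
    have h1 : f ∈ (J ⊔ Ideal.span {F x}) ⊔ starMonomialIdeal F (V.erase x) h (m - c x) c := by
      refine ih (hF.sup_span_singleton hx (Finset.notMem_erase x V) (Finset.erase_subset x V))
        _ _ fun T hT hTh => ?_
      have hxT : x ∉ T := fun h => Finset.notMem_erase x V (hT h)
      have h2 := hf (insert x T) (Finset.insert_subset hx (hT.trans (Finset.erase_subset x V)))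
        (by rw [Finset.card_insert_of_notMem hxT, hTh])
      rw [span_image_coe_insert, Finset.sum_insert hxT, ← Nat.sub_sub] at h2
      rw [sup_assoc]
      exact sup_le_sup_left (Ideal.sup_pow_le_sup_pow_right _ _ _) J h2
    obtain ⟨z, hz, g, hg, rfl⟩ := Submodule.mem_sup.1 h1
    obtain ⟨j, hj, w, hw, rfl⟩ := Submodule.mem_sup.1 hz
    obtain ⟨u, rfl⟩ := Ideal.mem_span_singleton.1 hw
    replace hg := starMonomialIdeal_erase_le F h m hx hmin hg
    refine add_mem (add_mem (Ideal.mem_sup_left hj) ?_) (Ideal.mem_sup_right hg)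
    have hu : u ∈ J ⊔ starMonomialIdeal F V (h + 1) m (c + Pi.single x 1) := by
      refine ihN _ ?_ _ (fun S hS hSh => ?_) rfl
      · rw [← hN]
        refine Finset.sum_lt_sum (fun i _ => Nat.sub_le_sub_left (by simp) _) ⟨x, hx, ?_⟩
        simp only [Pi.add_apply, Pi.single_eq_same]
        omega
      · have h2 : F x * u ∈ J ⊔ Ideal.span (F '' ↑S) ^ (m - ∑ i ∈ S, c i) := by
          have := sub_mem (sub_mem (hf S hS hSh)
            (Ideal.mem_sup_right (starMonomialIdeal_le F m c hS hSh hg))) (Ideal.mem_sup_left hj)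
          convert this using 1
          ring
        simp only [Pi.add_apply, Finset.sum_add_distrib]
        by_cases hxS : x ∈ S
        · rw [Finset.sum_pi_single' , if_pos hxS, ← Nat.sub_sub]
          exact hF.mem_sup_pow_pred_of_mem hS (by omega) hxS h2
        · rw [Finset.sum_pi_single', if_neg hxS, add_zero]
          exact hF.mem_sup_pow_of_notMem hS (by omega) hx hxS h2
    obtain ⟨j', hj', v, hv, rfl⟩ := Submodule.mem_sup.1 hu
    rw [mul_add]
    exact add_mem (Ideal.mem_sup_left (Ideal.mul_mem_left _ _ hj'))
      (Ideal.mem_sup_right (mul_mem_starMonomialIdeal F hx hv))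

variable [Fintype ι]

theorem prod_compl_mem_span (F : ι → R) {S T : Finset ι} (hST : S.card = T.card) (hne : T ≠ S) :
    ∏ j ∈ Sᶜ, F j ∈ Ideal.span (F '' ↑T) := by
  obtain ⟨j, hjT, hjS⟩ := Finset.not_subset.1 fun h => hne (Finset.eq_of_subset_of_card_le h hST.le)
  rw [← Finset.mul_prod_erase _ _ (Finset.mem_compl.2 hjS)]
  exact Ideal.mul_mem_right _ _ (Ideal.subset_span (Set.mem_image_of_mem F hjT))

theorem IsGenericallyRegular.mem_of_prod_compl_mul_mem {J : Ideal R} {F : ι → R} {d : ℕ}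
    (hF : IsGenericallyRegular J F Finset.univ d) {S : Finset ι} (hS : S.card < d) {u : R}
    (hu : (∏ j ∈ Sᶜ, F j) * u ∈ J ⊔ Ideal.span (F '' ↑S)) : u ∈ J ⊔ Ideal.span (F '' ↑S) := by
  have key : ∀ W ⊆ Sᶜ, ∀ u, (∏ j ∈ W, F j) * u ∈ J ⊔ Ideal.span (F '' ↑S) →
      u ∈ J ⊔ Ideal.span (F '' ↑S) := by
    intro W
    induction W using Finset.induction_on with
    | empty => simp
    | insert x W hx ih =>
      intro hW u hu
      rw [Finset.prod_insert hx, mul_assoc] at hu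
      exact ih ((Finset.subset_insert x W).trans hW) u (hF S (Finset.subset_univ S) hS x
        (Finset.mem_univ x) (Finset.mem_compl.1 (hW (Finset.mem_insert_self x W))) _ hu)
  exact key _ subset_rfl u hu

/-- The ideal of the codimension `h` star configuration defined by the family `F`. -/
def starIdeal (F : ι → R) (h : ℕ) : Ideal R :=
  ⨅ (S : Finset ι) (_ : S.card = h), Ideal.span (F '' ↑S)

omit [DecidableEq ι] [Fintype ι] in
theorem mem_starIdeal {F : ι → R} {h : ℕ} {f : R} :
    f ∈ starIdeal F h ↔ ∀ S : Finset ι, S.card = h → f ∈ Ideal.span (F '' ↑S) := by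
  simp [starIdeal]

omit [DecidableEq ι] [Fintype ι] in
theorem starIdeal_le (F : ι → R) {h : ℕ} {S : Finset ι} (hS : S.card = h) :
    starIdeal F h ≤ Ideal.span (F '' ↑S) :=
  iInf₂_le S hS

theorem prod_compl_mul_mem_starIdeal (F : ι → R) {S : Finset ι} {f : R}
    (hf : f ∈ Ideal.span (F '' ↑S)) : (∏ j ∈ Sᶜ, F j) * f ∈ starIdeal F S.card := by
  refine mem_starIdeal.2 fun T hT => ?_
  by_cases h : T = S
  · subst h
    exact Ideal.mul_mem_left _ _ hf
  · exact Ideal.mul_mem_right _ _ (prod_compl_mem_span F hT.symm h)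

theorem mem_associatedPrimes_quotient_iff [IsNoetherianRing R] {I P : Ideal R} :
    P ∈ associatedPrimes R (R ⧸ I) ↔ P.IsPrime ∧ ∃ g, ∀ a, a ∈ P ↔ a * g ∈ I := by
  rw [AssociatedPrimes.mem_iff, isAssociatedPrime_iff]
  refine and_congr_right fun _ => ?_
  rw [(Ideal.Quotient.mk_surjective (I := I)).exists]
  refine exists_congr fun g => ?_
  rw [SetLike.ext_iff]
  refine forall_congr' fun a => iff_congr Iff.rfl ?_
  rw [Submodule.mem_colon_singleton, Submodule.mem_bot, ← Ideal.Quotient.mk_eq_mk,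
    ← Submodule.Quotient.mk_smul, Submodule.Quotient.mk_eq_zero, smul_eq_mul]

theorem exists_mem_associatedPrimes_quotient [IsNoetherianRing R] {I : Ideal R} {f : R}
    (hf : f ∉ I) : ∃ P ∈ associatedPrimes R (R ⧸ I), ∀ a, a * f ∈ I → a ∈ P := by
  obtain ⟨P, hP, hle⟩ := exists_le_isAssociatedPrime_of_isNoetherianRing R
    (Ideal.Quotient.mk I f) (fun h => hf (Ideal.Quotient.eq_zero_iff_mem.1 h))
  refine ⟨P, hP, fun a ha => hle ?_⟩
  rw [Submodule.mem_colon_singleton, Submodule.mem_bot, ← Ideal.Quotient.mk_eq_mk,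
    ← Submodule.Quotient.mk_smul, Submodule.Quotient.mk_eq_zero, smul_eq_mul]
  exact ha

namespace IsGenericallyRegular

variable [IsNoetherianRing R] {F : ι → R} {h : ℕ}

theorem associatedPrimes_subset (hF : IsGenericallyRegular ⊥ F Finset.univ (h + 1))
    {S : Finset ι} (hS : S.card = h) :
    associatedPrimes R (R ⧸ Ideal.span (F '' ↑S)) ⊆ associatedPrimes R (R ⧸ starIdeal F h) := by
  intro P hP
  rw [mem_associatedPrimes_quotient_iff] at hP ⊢
  obtain ⟨hP, g, hg⟩ := hP
  refine ⟨hP, (∏ j ∈ Sᶜ, F j) * g, fun a => ?_⟩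
  rw [hg, mul_left_comm]
  refine ⟨fun ha => hS ▸ prod_compl_mul_mem_starIdeal F ha, fun ha => ?_⟩
  have := hF.mem_of_prod_compl_mul_mem (S := S) (u := a * g) (by omega)
  rw [bot_sup_eq] at this
  exact this (starIdeal_le F hS ha)

theorem exists_prod_compl_notMem (hF : IsGenericallyRegular ⊥ F Finset.univ (h + 1))
    {P : Ideal R} (hP : P ∈ associatedPrimes R (R ⧸ starIdeal F h)) :
    ∃ S : Finset ι, S.card = h ∧ ∏ j ∈ Sᶜ, F j ∉ P := by
  obtain ⟨hP, g, hg⟩ := mem_associatedPrimes_quotient_iff.1 hP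
  by_contra! hS
  refine hP.ne_top ((Ideal.eq_top_iff_one P).2 ((hg 1).2 ?_))
  rw [one_mul, mem_starIdeal]
  intro S hSh
  have := hF.mem_of_prod_compl_mul_mem (S := S) (u := g) (by omega)
  rw [bot_sup_eq] at this
  exact this (starIdeal_le F hSh ((hg _).1 (hS S hSh)))

theorem symbolicPower_starIdeal_le (hF : IsGenericallyRegular ⊥ F Finset.univ (h + 1))
    (m : ℕ) {S : Finset ι} (hS : S.card = h) :
    symbolicPower (starIdeal F h) m ≤ Ideal.span (F '' ↑S) ^ m := by
  intro f hf
  have key := mem_sup_pow_of_forall_mul_mem (J := ⊥) (F := F) (S := S)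
    (A := {s | s * f ∈ Ideal.span (F '' ↑S) ^ m}) (f := f)
    (hF.mono (Finset.subset_univ S) (by omega))
  simp only [bot_sup_eq] at key
  refine key (fun g hg => ?_) m fun a ha => ha
  by_contra hgS
  obtain ⟨P, hP, hle⟩ := exists_mem_associatedPrimes_quotient hgS
  obtain ⟨s, hsP, hs⟩ := hf P (hF.associatedPrimes_subset hS hP)
  exact hsP (hle s (hg s (Ideal.pow_right_mono (starIdeal_le F hS) m hs)))

/-- Symbolic powers of star configuration ideals are generated by monomials in the family. -/
theorem symbolicPower_starIdeal (hF : IsGenericallyRegular ⊥ F Finset.univ (h + 1)) (m : ℕ) :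
    symbolicPower (starIdeal F h) m = starMonomialIdeal F Finset.univ h m 0 := by
  refine le_antisymm (fun f hf => ?_) fun f hf P hP => ?_
  · have := hF.mem_sup_starMonomialIdeal m 0 (f := f) fun S _ hS => by
      simpa using hF.symbolicPower_starIdeal_le m hS hf
    rwa [bot_sup_eq] at this
  · obtain ⟨S, hS, hSP⟩ := hF.exists_prod_compl_notMem hP
    have hPp := (mem_associatedPrimes_quotient_iff.1 hP).1
    refine ⟨(∏ j ∈ Sᶜ, F j) ^ m, fun h => hSP (hPp.mem_of_pow_mem _ h), ?_⟩
    have hfS : f ∈ Ideal.span (F '' ↑S) ^ m := by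
      simpa using starMonomialIdeal_le F m 0 (Finset.subset_univ S) hS hf
    have hle : Ideal.span {∏ j ∈ Sᶜ, F j} * Ideal.span (F '' ↑S) ≤ starIdeal F h := by
      rw [Ideal.span_singleton_mul_le_iff]
      exact fun g hg => hS ▸ prod_compl_mul_mem_starIdeal F hg
    refine Ideal.pow_right_mono hle m ?_
    rw [mul_pow]
    exact Ideal.mul_mem_mul (Ideal.pow_mem_pow (Ideal.mem_span_singleton_self _) m) hfS

end IsGenericallyRegular

theorem exists_le_sum_eq {h m : ℕ} (hm : 1 ≤ m) (hh : h ≤ Fintype.card ι) (c : ι → ℕ)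
    (hc : ∀ S : Finset ι, S.card = h → m ≤ ∑ i ∈ S, c i) :
    ∃ b ≤ c, (∀ S : Finset ι, S.card = h → m ≤ ∑ i ∈ S, b i) ∧
      ∃ T : Finset ι, T.card = h ∧ ∑ i ∈ T, b i = m := by
  induction hN : ∑ i, c i using Nat.strong_induction_on generalizing c with
  | _ N ih =>
  obtain ⟨S, -, hS⟩ := Finset.exists_subset_card_eq (s := (Finset.univ : Finset ι)) hh
  obtain ⟨x, hxS, hx⟩ : ∃ x ∈ S, c x ≠ 0 := by
    by_contra! h0
    have := hc S hS
    rw [Finset.sum_eq_zero h0] at this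
    omega
  have hsum : ∀ T : Finset ι, ∑ i ∈ T, c i ≤ ∑ i ∈ T, (c - Pi.single x 1 : ι → ℕ) i + 1 := by
    intro T
    calc ∑ i ∈ T, c i ≤ ∑ i ∈ T, ((c - Pi.single x 1 : ι → ℕ) i + (Pi.single x 1 : ι → ℕ) i) :=
          Finset.sum_le_sum fun i _ => by simp only [Pi.sub_apply]; omega
      _ ≤ _ := by
          rw [Finset.sum_add_distrib, Finset.sum_pi_single']
          split_ifs <;> omega
  by_cases hT : ∀ T : Finset ι, T.card = h → m ≤ ∑ i ∈ T, (c - Pi.single x 1 : ι → ℕ) i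
  · obtain ⟨b, hb, h1, h2⟩ := ih _ (by
      rw [← hN]
      refine Finset.sum_lt_sum (fun i _ => by simp) ⟨x, Finset.mem_univ x, ?_⟩
      simp only [Pi.sub_apply, Pi.single_eq_same]
      omega) _ hT rfl
    exact ⟨b, hb.trans tsub_le_self, h1, h2⟩
  · push Not at hT
    obtain ⟨T, hTh, hTm⟩ := hT
    refine ⟨c, le_rfl, hc, T, hTh, ?_⟩
    have := hc T hTh
    have := hsum T
    omega

omit [DecidableEq ι] [Fintype ι] in
theorem le_sum_div {h m r : ℕ} (hh : 1 ≤ h) (hr : 1 ≤ r) (a : ι → ℕ) {S : Finset ι}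
    (hS : S.card = h) (ha : r * (m + h - 1) ≤ ∑ i ∈ S, a i) : m ≤ ∑ i ∈ S, a i / r := by
  have h1 : ∑ i ∈ S, a i + h ≤ ∑ i ∈ S, r * (a i / r) + h * r := by
    rw [← hS, Finset.card_eq_sum_ones, Finset.sum_mul, ← Finset.sum_add_distrib,
      ← Finset.sum_add_distrib]
    refine Finset.sum_le_sum fun i _ => ?_
    have h2 := Nat.div_add_mod (a i) r
    have h3 := Nat.mod_lt (a i) hr
    omega
  rw [← Finset.mul_sum] at h1
  obtain ⟨h, rfl⟩ := Nat.exists_eq_add_of_le' hh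
  rw [← Nat.add_assoc, Nat.add_sub_cancel] at ha
  by_contra! hlt
  have h4 : r * (∑ i ∈ S, a i / r + 1) ≤ r * m := Nat.mul_le_mul_left r hlt
  linarith [mul_add r m h, add_mul h 1 r, mul_comm r h, mul_add r (∑ i ∈ S, a i / r) 1]

theorem starMonomialIdeal_le_pow_mul_pow {F : ι → R} {M : Ideal R} (hFM : ∀ i, F i ∈ M)
    {h m r : ℕ} (hh : 1 ≤ h) (hι : h ≤ Fintype.card ι) (hm : 1 ≤ m) (hr : 1 ≤ r) :
    starMonomialIdeal F Finset.univ h (r * (m + h - 1)) 0 ≤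
      M ^ (r * (h - 1)) * starMonomialIdeal F Finset.univ h m 0 ^ r := by
  refine Ideal.span_le.2 ?_
  rintro _ ⟨a, ha, rfl⟩
  simp only [Pi.zero_apply, add_zero] at ha
  obtain ⟨b, hb, hbm, T, hT, hbT⟩ := exists_le_sum_eq hm hι (fun i => a i / r)
    fun S hS => le_sum_div hh hr a hS (ha S (Finset.subset_univ S) hS)
  have hba : ∀ i, b i * r ≤ a i := fun i =>
    (Nat.mul_le_mul_right r (hb i)).trans (Nat.div_mul_le_self _ _)
  have hprod : ∏ i, F i ^ a i = (∏ i, F i ^ (a i - b i * r)) * (∏ i, F i ^ b i) ^ r := by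
    rw [← Finset.prod_pow, ← Finset.prod_mul_distrib]
    refine Finset.prod_congr rfl fun i _ => ?_
    rw [← pow_mul, ← pow_add, Nat.sub_add_cancel (hba i)]
  rw [SetLike.mem_coe, hprod]
  refine Ideal.mul_mem_mul ?_ (Ideal.pow_mem_pow ?_ r)
  swap
  · exact Ideal.subset_span ⟨b, fun S _ hS => by simpa using hbm S hS, rfl⟩
  have hle : r * (h - 1) ≤ ∑ i, (a i - b i * r) := by
    refine le_trans ?_ (Finset.sum_le_sum_of_subset (Finset.subset_univ T))
    have h1 := ha T (Finset.subset_univ T) hT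
    have h2 : ∑ i ∈ T, a i = ∑ i ∈ T, (a i - b i * r) + ∑ i ∈ T, b i * r := by
      rw [← Finset.sum_add_distrib]
      exact Finset.sum_congr rfl fun i _ => (Nat.sub_add_cancel (hba i)).symm
    rw [← Finset.sum_mul, hbT] at h2
    rw [Nat.add_sub_assoc hh, mul_add, mul_comm r m] at h1
    omega
  refine Ideal.pow_le_pow_right hle ?_
  rw [← Finset.prod_pow_eq_pow_sum]
  exact Ideal.prod_mem_prod fun i _ => Ideal.pow_mem_pow (hFM i) _

omit [DecidableEq ι] in
/-- A family all of whose lists of at most `d` distinct members are weakly regular sequences is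
generically regular. -/
theorem isGenericallyRegular_of_isWeaklyRegular {F : ι → R} {d : ℕ}
    (hF : ∀ l : List ι, l.Nodup → l.length ≤ d →
      RingTheory.Sequence.IsWeaklyRegular R (l.map F)) :
    IsGenericallyRegular ⊥ F Finset.univ d := by
  intro T _ hT i _ hiT u hu
  have h1 := hF (T.toList ++ [i])
    (List.nodup_append.2 ⟨T.nodup_toList, List.nodup_singleton i, by
      rintro a ha b hb rfl
      rw [List.mem_singleton] at hb
      exact hiT (hb ▸ Finset.mem_toList.1 ha)⟩)
    (by rw [List.length_append, Finset.length_toList]; exact hT)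
  rw [List.map_append, List.map_singleton,
    RingTheory.Sequence.isWeaklyRegular_append_iff,
    RingTheory.Sequence.isWeaklyRegular_singleton_iff] at h1
  have h2 : (Ideal.ofList (T.toList.map F) • ⊤ : Submodule R R) = Ideal.span (F '' ↑T) := by
    rw [smul_eq_mul, Ideal.mul_top, Ideal.ofList]
    congr 1
    ext
    simp
  rw [h2] at h1
  rw [bot_sup_eq] at hu ⊢
  rw [← Submodule.Quotient.mk_eq_zero]
  refine h1.2.right_eq_zero_of_smul ?_
  rwa [← Submodule.Quotient.mk_smul, Submodule.Quotient.mk_eq_zero]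

end GenericallyRegular

theorem MvPolynomial.IsHomogeneous.mem_idealOfVars {σ k : Type*} [Field k] {f : MvPolynomial σ k}
    {d : ℕ} (hf : f.IsHomogeneous d) (hunit : ¬IsUnit f) : f ∈ MvPolynomial.idealOfVars σ k := by
  rw [← pow_one (MvPolynomial.idealOfVars σ k), MvPolynomial.mem_pow_idealOfVars_iff]
  intro x hx
  rw [Nat.one_le_iff_ne_zero]
  intro h0
  have hd : d = 0 := by
    rw [← hf (MvPolynomial.mem_support_iff.1 hx), ← h0]
    rw [Finsupp.degree_eq_weight_one]
    rfl
  subst hd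
  obtain ⟨c, rfl⟩ : ∃ c, f = MvPolynomial.C c :=
    ⟨_, MvPolynomial.totalDegree_eq_zero_iff_eq_C.1 (Nat.le_zero.1 hf.totalDegree_le)⟩
  refine hunit ((Ne.isUnit ?_).map MvPolynomial.C)
  rintro rfl
  simp at hx

/-- **Corollary `cor.DemaillySC` (containment).** Let `I` be the defining ideal of a
codimension `h` star configuration in `ℙ^N_k` given by homogeneous forms `F_1,…,F_n` any
`h+1` of which form a complete intersection (regular sequence).  Then for all `m, r ≥ 1`,
`I^{(r(m+h−1))} ⊆ 𝔪^{r(h−1)} (I^{(m)})^r`. -/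
theorem stmt_10 {k : Type*} [Field k] (N n h : ℕ) (hh : 1 ≤ h) (hhN : h ≤ N) (hhn : h ≤ n)
    (F : Fin n → MvPolynomial (Fin (N + 1)) k)
    (hFhom : ∀ i, ∃ d, MvPolynomial.IsHomogeneous (F i) d)
    (hCI : ∀ l : List (Fin n), l.Nodup → l.length ≤ h + 1 →
      RingTheory.Sequence.IsRegular (MvPolynomial (Fin (N + 1)) k) (l.map F))
    (I : Ideal (MvPolynomial (Fin (N + 1)) k))
    (hI : I = ⨅ (S : Finset (Fin n)) (_ : S.card = h), Ideal.span (F '' ↑S)) :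
    ∀ m r : ℕ, 1 ≤ m → 1 ≤ r →
      symbolicPower I (r * (m + h - 1)) ≤
        (Ideal.span (Set.range (MvPolynomial.X : Fin (N + 1) → MvPolynomial (Fin (N + 1)) k)))
            ^ (r * (h - 1)) * (symbolicPower I m) ^ r := by
  intro m r hm hr
  have hF : IsGenericallyRegular ⊥ F Finset.univ (h + 1) :=
    isGenericallyRegular_of_isWeaklyRegular fun l hl hlh => (hCI l hl hlh).toIsWeaklyRegular
  have hFM : ∀ i, F i ∈ MvPolynomial.idealOfVars (Fin (N + 1)) k := by
    intro i
    obtain ⟨d, hd⟩ := hFhom i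
    refine hd.mem_idealOfVars fun hu => ?_
    have := (hCI [i] (List.nodup_singleton i) (by simp)).top_ne_smul
    simp [Ideal.span_singleton_eq_top.2 hu] at this
  obtain rfl : I = starIdeal F h := hI
  rw [hF.symbolicPower_starIdeal, hF.symbolicPower_starIdeal]
  exact starMonomialIdeal_le_pow_mul_pow hFM hh (by simpa using hhn) hm hr
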